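/- arXiv:1803.00856 — 2 statements merged into one kernel-verified Lean document; each statement's English description precedes it below -/
import Mathlib

section
/- Let k>1. A C² 2π-periodic function φ : ℝ → ℝ² satisfies 𝓙(φ) = 0 identically if and only if φ is a real linear combination of the three functions ω', e₁ ≡ (1,0), and ω. (That is, the kernel of the linearization of the constant-curvature-k loop equation at ω coincides with the tangent space at ω of the three-dimensional manifold of solutions generated by parameter rotations and hyperbolic translations.) -/
open Real MeasureTheory Filter Topology

noncomputable section

/-- Rotation by π/2 in the plane: `iw = (-w₂, w₁)`. -/
def rot (w : ℝ × ℝ) : ℝ × ℝ := (-w.2, w.1)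

/-- The Christoffel-type term `Γ(w) = (2w₁w₂, w₂² - w₁²)`. -/
def Gam (w : ℝ × ℝ) : ℝ × ℝ := (2 * w.1 * w.2, w.2 ^ 2 - w.1 ^ 2)

/-- Euclidean dot product in ℝ². -/
def dotp (v w : ℝ × ℝ) : ℝ := v.1 * w.1 + v.2 * w.2

/-- The hyperbolic length-type functional `L(u) = ((1/2π)∫₀^{2π} u₂⁻²|u'|² dt)^{1/2}`. -/
def hypL (u : ℝ → ℝ × ℝ) : ℝ :=
  Real.sqrt ((1 / (2 * π)) * ∫ t in (0:ℝ)..(2 * π),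
    ((deriv u t).1 ^ 2 + (deriv u t).2 ^ 2) / (u t).2 ^ 2)

/-- `u` is a `K`-loop in the upper half-plane model of the hyperbolic plane:
a nonconstant C² `2π`-periodic curve with values in `H²` solving
`u'' - u₂⁻¹ Γ(u') = L(u) K(u) iu'`. -/
def IsKLoop (K : (ℝ × ℝ) → ℝ) (u : ℝ → ℝ × ℝ) : Prop :=
  ContDiff ℝ 2 u ∧ Function.Periodic u (2 * π) ∧ (∀ t, 0 < (u t).2) ∧
  (¬ ∃ c, ∀ t, u t = c) ∧
  ∀ t, deriv (deriv u) t - ((u t).2)⁻¹ • Gam (deriv u t)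
      = (hypL u * K (u t)) • rot (deriv u t)

/-- A `2π`-periodic curve is embedded if it is injective modulo `2π`. -/
def IsEmbedded (u : ℝ → ℝ × ℝ) : Prop :=
  ∀ t s : ℝ, u t = u s → ∃ n : ℤ, t - s = 2 * π * (n : ℝ)

/-- `R_k = (k² - 1)^{-1/2}`. -/
def Rk (k : ℝ) : ℝ := 1 / Real.sqrt (k ^ 2 - 1)

/-- The reference loop `ω(t) = (cos t, 1/R_k) / (k - sin t)`, a parameterization of the
hyperbolic circle of center `(0,1)` and hyperbolic radius `ρ_k = artanh(1/k)`. -/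
def om (k : ℝ) (t : ℝ) : ℝ × ℝ := (cos t / (k - sin t), (1 / Rk k) / (k - sin t))

/-- The differential `Γ'(w)v = 2(v₂ w - v₁ iw)`. -/
def Gam' (w v : ℝ × ℝ) : ℝ × ℝ := (2 * v.2) • w - (2 * v.1) • rot w

/-- The operator `𝓙`, equal to `ω₂²` times the linearization at `ω` of the
constant-curvature-`k` loop equation:
`𝓙(φ) = -φ'' + kR_k iφ' + ω₂⁻¹Γ'(ω')φ' - ω₂⁻²φ₂Γ(ω') - k²(⨍ ω₂⁻²φ·iω') iω'`. -/
def Jop (k : ℝ) (φ : ℝ → ℝ × ℝ) (t : ℝ) : ℝ × ℝ :=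
  -(deriv (deriv φ) t) + (k * Rk k) • rot (deriv φ t)
    + ((om k t).2)⁻¹ • Gam' (deriv (om k) t) (deriv φ t)
    - ((φ t).2 / (om k t).2 ^ 2) • Gam (deriv (om k) t)
    - (k ^ 2 * ((1 / (2 * π)) * ∫ s in (0:ℝ)..(2 * π),
        dotp (φ s) (rot (deriv (om k) s)) / (om k s).2 ^ 2)) • rot (deriv (om k) t)

/-- The operator `B g = -g'' - kR_k ig' + R_k²(g₂ - k² ⨍ g₂) e₂`. -/
def Bop (k : ℝ) (g : ℝ → ℝ × ℝ) (t : ℝ) : ℝ × ℝ :=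
  -(deriv (deriv g) t) - (k * Rk k) • rot (deriv g t)
    + (Rk k ^ 2 * ((g t).2 - k ^ 2 * ((1 / (2 * π)) * ∫ s in (0:ℝ)..(2 * π), (g s).2)))
        • ((0:ℝ), (1:ℝ))

/-- The `ω'`-coordinate of `𝓙(φ)`, as an identity between the pointwise values: `f`, `d`, `e` stand
for `φ`, `φ'`, `φ''`, and `q`, `s`, `c`, `m` for `1 / R_k`, `sin t`, `cos t` and the mean value. -/
lemma tangent_identity (k q s c m f1 f2 d1 d2 e1 e2 : ℝ) (h1 : s ^ 2 + c ^ 2 = 1)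
    (h2 : q ^ 2 = k ^ 2 - 1) (hD : k - s ≠ 0) (hq : q ≠ 0) :
    (1 - k * s) * (-e1 - k / q * d2
        + (k - s) / q * (2 * d2 * ((1 - k * s) / (k - s) ^ 2) + 2 * d1 * (q * c / (k - s) ^ 2))
        - f2 * (k - s) ^ 2 / q ^ 2 * (2 * ((1 - k * s) / (k - s) ^ 2) * (q * c / (k - s) ^ 2))
        + k ^ 2 * m * (q * c / (k - s) ^ 2))
      + q * c * (-e2 + k / q * d1
        + (k - s) / q * (2 * d2 * (q * c / (k - s) ^ 2) - 2 * d1 * ((1 - k * s) / (k - s) ^ 2))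
        - f2 * (k - s) ^ 2 / q ^ 2 * ((q * c / (k - s) ^ 2) ^ 2 - ((1 - k * s) / (k - s) ^ 2) ^ 2)
        - k ^ 2 * m * ((1 - k * s) / (k - s) ^ 2))
      = -(e1 * (1 - k * s) - 2 * d1 * k * c + f1 * k * s + e2 * q * c - 2 * d2 * q * s - f2 * q * c)
        + k / q * (-d1 * q * c + f1 * q * s + d2 * (1 - k * s) - f2 * k * c) := by
  have hc : c ^ 2 = 1 - s ^ 2 := by linarith
  have hT : (1 - k * s) ^ 2 + q ^ 2 * c ^ 2 = (k - s) ^ 2 := by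
    rw [hc, h2]
    ring
  field_simp
  grind

/-- The `iω'`-coordinate of `𝓙(φ)`, in the notation of `tangent_identity`. -/
lemma normal_identity (k q s c m f1 f2 d1 d2 e1 e2 : ℝ) (h1 : s ^ 2 + c ^ 2 = 1)
    (h2 : q ^ 2 = k ^ 2 - 1) (hD : k - s ≠ 0) (hq : q ≠ 0) :
    -(q * c) * (-e1 - k / q * d2
        + (k - s) / q * (2 * d2 * ((1 - k * s) / (k - s) ^ 2) + 2 * d1 * (q * c / (k - s) ^ 2))
        - f2 * (k - s) ^ 2 / q ^ 2 * (2 * ((1 - k * s) / (k - s) ^ 2) * (q * c / (k - s) ^ 2))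
        + k ^ 2 * m * (q * c / (k - s) ^ 2))
      + (1 - k * s) * (-e2 + k / q * d1
        + (k - s) / q * (2 * d2 * (q * c / (k - s) ^ 2) - 2 * d1 * ((1 - k * s) / (k - s) ^ 2))
        - f2 * (k - s) ^ 2 / q ^ 2 * ((q * c / (k - s) ^ 2) ^ 2 - ((1 - k * s) / (k - s) ^ 2) ^ 2)
        - k ^ 2 * m * ((1 - k * s) / (k - s) ^ 2))
      = -(-e1 * q * c + 2 * d1 * q * s + f1 * q * c + e2 * (1 - k * s) - 2 * d2 * k * c
          + f2 * k * s)
        - k / q * (d1 * (1 - k * s) - f1 * k * c + d2 * q * c - f2 * q * s)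
        + (-f1 * q * c + f2 * (1 - k * s)) / q ^ 2 - k ^ 2 * m := by
  have hc : c ^ 2 = 1 - s ^ 2 := by linarith
  have hT : (1 - k * s) ^ 2 + q ^ 2 * c ^ 2 = (k - s) ^ 2 := by
    rw [hc, h2]
    ring
  field_simp
  grind

lemma hasDerivAt_fst_comp {φ : ℝ → ℝ × ℝ} {v : ℝ × ℝ} {t : ℝ} (h : HasDerivAt φ v t) :
    HasDerivAt (fun s => (φ s).1) v.1 t :=
  (hasFDerivAt_fst (𝕜 := ℝ) (p := φ t)).comp_hasDerivAt t h

lemma hasDerivAt_snd_comp {φ : ℝ → ℝ × ℝ} {v : ℝ × ℝ} {t : ℝ} (h : HasDerivAt φ v t) :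
    HasDerivAt (fun s => (φ s).2) v.2 t :=
  (hasFDerivAt_snd (𝕜 := ℝ) (p := φ t)).comp_hasDerivAt t h

/-- The coefficient of `φ` along `ω'` in the orthogonal frame `(ω', iω')`. -/
def tangentCoord (k : ℝ) (φ : ℝ → ℝ × ℝ) (t : ℝ) : ℝ :=
  (φ t).1 * (1 - k * sin t) + (φ t).2 * (√(k ^ 2 - 1) * cos t)

/-- The coefficient of `φ` along `iω'` in the orthogonal frame `(ω', iω')`. -/
def normalCoord (k : ℝ) (φ : ℝ → ℝ × ℝ) (t : ℝ) : ℝ :=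
  -(φ t).1 * (√(k ^ 2 - 1) * cos t) + (φ t).2 * (1 - k * sin t)

lemma sub_sin_pos {k : ℝ} (hk : 1 < k) (t : ℝ) : 0 < k - sin t := by
  linarith [sin_le_one t]

lemma sq_sub_one_pos {k : ℝ} (hk : 1 < k) : 0 < k ^ 2 - 1 := by nlinarith

lemma hasDerivAt_om {k : ℝ} (hk : 1 < k) (t : ℝ) :
    HasDerivAt (om k) ((1 - k * sin t) / (k - sin t) ^ 2,
      √(k ^ 2 - 1) * cos t / (k - sin t) ^ 2) t := by
  have hD := (sub_sin_pos hk t).ne'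
  have hden : HasDerivAt (fun s => k - sin s) (-cos t) t := (hasDerivAt_sin t).const_sub k
  refine HasDerivAt.prodMk ?_ ?_
  · refine HasDerivAt.congr_deriv ((hasDerivAt_cos t).div hden hD) ?_
    congr 1
    linear_combination sin_sq_add_cos_sq t
  · refine HasDerivAt.congr_deriv ((hasDerivAt_const t (1 / Rk k)).div hden hD) ?_
    simp [Rk]

lemma deriv_om {k : ℝ} (hk : 1 < k) (t : ℝ) :
    deriv (om k) t = ((1 - k * sin t) / (k - sin t) ^ 2,
      √(k ^ 2 - 1) * cos t / (k - sin t) ^ 2) :=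
  (hasDerivAt_om hk t).deriv

lemma om_snd (k t : ℝ) : (om k t).2 = √(k ^ 2 - 1) / (k - sin t) := by simp [om, Rk]

/-- The squared speed of `ω` in the coordinates cleared of denominators. -/
lemma speed_identity {k : ℝ} (hk : 1 < k) (t : ℝ) :
    (1 - k * sin t) ^ 2 + (√(k ^ 2 - 1) * cos t) ^ 2 = (k - sin t) ^ 2 := by
  rw [mul_pow, sq_sqrt (sq_sub_one_pos hk).le, cos_sq']
  ring

lemma hasDerivAt_tangentCoord {k : ℝ} {φ : ℝ → ℝ × ℝ} {v : ℝ × ℝ} {t : ℝ}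
    (h : HasDerivAt φ v t) :
    HasDerivAt (tangentCoord k φ) (v.1 * (1 - k * sin t) - (φ t).1 * k * cos t
      + v.2 * √(k ^ 2 - 1) * cos t - (φ t).2 * √(k ^ 2 - 1) * sin t) t := by
  have hA : HasDerivAt (fun s => 1 - k * sin s) (-(k * cos t)) t :=
    ((hasDerivAt_sin t).const_mul k).const_sub 1
  have hB := (hasDerivAt_cos t).const_mul √(k ^ 2 - 1)
  refine HasDerivAt.congr_deriv
    (((hasDerivAt_fst_comp h).mul hA).add ((hasDerivAt_snd_comp h).mul hB)) ?_
  ring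

lemma hasDerivAt_normalCoord {k : ℝ} {φ : ℝ → ℝ × ℝ} {v : ℝ × ℝ} {t : ℝ}
    (h : HasDerivAt φ v t) :
    HasDerivAt (normalCoord k φ) (-v.1 * √(k ^ 2 - 1) * cos t + (φ t).1 * √(k ^ 2 - 1) * sin t
      + v.2 * (1 - k * sin t) - (φ t).2 * k * cos t) t := by
  have hA : HasDerivAt (fun s => 1 - k * sin s) (-(k * cos t)) t :=
    ((hasDerivAt_sin t).const_mul k).const_sub 1
  have hB := (hasDerivAt_cos t).const_mul √(k ^ 2 - 1)
  refine HasDerivAt.congr_deriv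
    (((hasDerivAt_fst_comp h).neg.mul hB).add ((hasDerivAt_snd_comp h).mul hA)) ?_
  simp only [Pi.neg_apply]
  ring

lemma hasDerivAt_deriv_tangentCoord {k : ℝ} {φ : ℝ → ℝ × ℝ} (hφ : ContDiff ℝ 2 φ) (t : ℝ) :
    HasDerivAt (deriv (tangentCoord k φ)) ((deriv (deriv φ) t).1 * (1 - k * sin t)
      - 2 * (deriv φ t).1 * k * cos t + (φ t).1 * k * sin t
      + (deriv (deriv φ) t).2 * √(k ^ 2 - 1) * cos t
      - 2 * (deriv φ t).2 * √(k ^ 2 - 1) * sin t - (φ t).2 * √(k ^ 2 - 1) * cos t) t := by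
  have h1 (s : ℝ) := (hφ.differentiable (by norm_num) s).hasDerivAt
  have h2 := (hφ.differentiable_deriv_two t).hasDerivAt
  rw [funext fun s => (hasDerivAt_tangentCoord (k := k) (h1 s)).deriv]
  have hA : HasDerivAt (fun s => 1 - k * sin s) (-(k * cos t)) t :=
    ((hasDerivAt_sin t).const_mul k).const_sub 1
  refine HasDerivAt.congr_deriv
    (((((hasDerivAt_fst_comp h2).mul hA).sub
    (((hasDerivAt_fst_comp (h1 t)).mul_const k).mul (hasDerivAt_cos t))).add
    (((hasDerivAt_snd_comp h2).mul_const √(k ^ 2 - 1)).mul (hasDerivAt_cos t))).sub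
    (((hasDerivAt_snd_comp (h1 t)).mul_const √(k ^ 2 - 1)).mul (hasDerivAt_sin t))) ?_
  ring

lemma hasDerivAt_deriv_normalCoord {k : ℝ} {φ : ℝ → ℝ × ℝ} (hφ : ContDiff ℝ 2 φ) (t : ℝ) :
    HasDerivAt (deriv (normalCoord k φ)) (-(deriv (deriv φ) t).1 * √(k ^ 2 - 1) * cos t
      + 2 * (deriv φ t).1 * √(k ^ 2 - 1) * sin t + (φ t).1 * √(k ^ 2 - 1) * cos t
      + (deriv (deriv φ) t).2 * (1 - k * sin t)
      - 2 * (deriv φ t).2 * k * cos t + (φ t).2 * k * sin t) t := by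
  have h1 (s : ℝ) := (hφ.differentiable (by norm_num) s).hasDerivAt
  have h2 := (hφ.differentiable_deriv_two t).hasDerivAt
  rw [funext fun s => (hasDerivAt_normalCoord (k := k) (h1 s)).deriv]
  have hA : HasDerivAt (fun s => 1 - k * sin s) (-(k * cos t)) t :=
    ((hasDerivAt_sin t).const_mul k).const_sub 1
  refine HasDerivAt.congr_deriv
    ((((((hasDerivAt_fst_comp h2).neg.mul_const √(k ^ 2 - 1)).mul (hasDerivAt_cos t)).add
    (((hasDerivAt_fst_comp (h1 t)).mul_const √(k ^ 2 - 1)).mul (hasDerivAt_sin t))).add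
    ((hasDerivAt_snd_comp h2).mul hA)).sub
    (((hasDerivAt_snd_comp (h1 t)).mul_const k).mul (hasDerivAt_cos t))) ?_
  simp only [Pi.neg_apply]
  ring

lemma integrand_eq_normalCoord {k : ℝ} (hk : 1 < k) (φ : ℝ → ℝ × ℝ) (s : ℝ) :
    dotp (φ s) (rot (deriv (om k) s)) / (om k s).2 ^ 2 = normalCoord k φ s / (k ^ 2 - 1) := by
  have hD := (sub_sin_pos hk s).ne'
  have hq := (sq_sub_one_pos hk).ne'
  rw [deriv_om hk, om_snd, div_pow, sq_sqrt (sq_sub_one_pos hk).le]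
  simp only [dotp, rot, normalCoord]
  field_simp

/-- A plane vector vanishes iff its two coordinates in an orthogonal frame do. -/
lemma eq_zero_iff_frame {A B : ℝ} (h : A ^ 2 + B ^ 2 ≠ 0) (v : ℝ × ℝ) :
    v = 0 ↔ A * v.1 + B * v.2 = 0 ∧ -B * v.1 + A * v.2 = 0 := by
  constructor
  · rintro rfl
    simp
  · rintro ⟨h1, h2⟩
    ext
    · refine (mul_eq_zero.1 ?_).resolve_left h
      linear_combination A * h1 - B * h2
    · refine (mul_eq_zero.1 ?_).resolve_left h
      linear_combination B * h1 + A * h2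

/-- In the frame `(ω', iω')` the equation `𝓙(φ) = 0` becomes a constant-coefficient system. -/
lemma Jop_eq_zero_iff {k : ℝ} (hk : 1 < k) {φ : ℝ → ℝ × ℝ} (hφ : ContDiff ℝ 2 φ) (t : ℝ) :
    Jop k φ t = 0 ↔
      deriv (deriv (tangentCoord k φ)) t = k / √(k ^ 2 - 1) * deriv (normalCoord k φ) t ∧
      deriv (deriv (normalCoord k φ)) t = -(k / √(k ^ 2 - 1) * deriv (tangentCoord k φ) t)
        + normalCoord k φ t / (k ^ 2 - 1)
        - k ^ 2 * ((1 / (2 * π)) * ∫ s in (0:ℝ)..(2 * π), normalCoord k φ s / (k ^ 2 - 1)) := by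
  have hD := (sub_sin_pos hk t).ne'
  have hqq := sq_sqrt (sq_sub_one_pos hk).le
  have hq := (sqrt_pos.2 (sq_sub_one_pos hk)).ne'
  have h1 := (hφ.differentiable (by norm_num) t).hasDerivAt
  have hframe : (1 - k * sin t) ^ 2 + (√(k ^ 2 - 1) * cos t) ^ 2 ≠ 0 := by
    rw [speed_identity hk]
    exact pow_ne_zero 2 hD
  rw [eq_zero_iff_frame hframe, (hasDerivAt_deriv_tangentCoord hφ t).deriv,
    (hasDerivAt_deriv_normalCoord hφ t).deriv, (hasDerivAt_tangentCoord h1).deriv,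
    (hasDerivAt_normalCoord h1).deriv]
  simp only [Jop, integrand_eq_normalCoord hk]
  generalize (1 / (2 * π)) * ∫ s in (0:ℝ)..(2 * π), normalCoord k φ s / (k ^ 2 - 1) = m
  have i1 := tangent_identity k √(k ^ 2 - 1) (sin t) (cos t) m (φ t).1 (φ t).2 (deriv φ t).1
    (deriv φ t).2 (deriv (deriv φ) t).1 (deriv (deriv φ) t).2 (sin_sq_add_cos_sq t) hqq hD hq
  have i2 := normal_identity k √(k ^ 2 - 1) (sin t) (cos t) m (φ t).1 (φ t).2 (deriv φ t).1
    (deriv φ t).2 (deriv (deriv φ) t).1 (deriv (deriv φ) t).2 (sin_sq_add_cos_sq t) hqq hD hq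
  rw [deriv_om hk, om_snd]
  simp only [Rk, rot, Gam', Gam, normalCoord, Prod.fst_add, Prod.snd_add, Prod.fst_sub,
    Prod.snd_sub, Prod.fst_neg, Prod.snd_neg, Prod.smul_fst, Prod.smul_snd, smul_eq_mul, inv_div,
    div_pow, div_div_eq_mul_div] at i1 i2 ⊢
  generalize √(k ^ 2 - 1) = q at *
  rw [← hqq]
  refine and_congr ⟨fun h => ?_, fun h => ?_⟩ ⟨fun h => ?_, fun h => ?_⟩
  · linear_combination i1 - h
  · linear_combination i1 - h
  · linear_combination i2 - h
  · linear_combination i2 - h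

/-- The solutions of the harmonic oscillator equation. -/
lemma eq_cos_add_sin_of_harmonic {y y' : ℝ → ℝ} (hy : ∀ t, HasDerivAt y (y' t) t)
    (hy' : ∀ t, HasDerivAt y' (-y t) t) (t : ℝ) : y t = y 0 * cos t + y' 0 * sin t := by
  have hu (s : ℝ) : HasDerivAt (fun s => y s * cos s - y' s * sin s) 0 s := by
    refine HasDerivAt.congr_deriv
      (((hy s).mul (hasDerivAt_cos s)).sub ((hy' s).mul (hasDerivAt_sin s))) ?_
    ring
  have hv (s : ℝ) : HasDerivAt (fun s => y s * sin s + y' s * cos s) 0 s := by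
    refine HasDerivAt.congr_deriv
      (((hy s).mul (hasDerivAt_sin s)).add ((hy' s).mul (hasDerivAt_cos s))) ?_
    ring
  have h1 := is_const_of_deriv_eq_zero (fun s => (hu s).differentiableAt)
    (fun s => (hu s).deriv) t 0
  have h2 := is_const_of_deriv_eq_zero (fun s => (hv s).differentiableAt)
    (fun s => (hv s).deriv) t 0
  simp only [cos_zero, sin_zero] at h1 h2
  linear_combination cos t * h1 + sin t * h2 - y t * sin_sq_add_cos_sq t

/-- The `2π`-periodic solutions of the constant-coefficient system for the frame coordinates. -/
lemma periodic_system_solution {k q : ℝ} (hq : q ≠ 0) (hqk : q ^ 2 = k ^ 2 - 1)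
    {g g' h h' : ℝ → ℝ} (hg : ∀ t, HasDerivAt g (g' t) t) (hh : ∀ t, HasDerivAt h (h' t) t)
    (hg' : ∀ t, HasDerivAt g' (k / q * h' t) t)
    (hh' : ∀ t, HasDerivAt h' (-(k / q * g' t) + h t / (k ^ 2 - 1)
      - k ^ 2 * ((1 / (2 * π)) * ∫ s in (0:ℝ)..(2 * π), h s / (k ^ 2 - 1))) t)
    (hper : g (2 * π) = g 0) :
    ∃ α β γ : ℝ, ∀ t, g t = γ + k / q * (α * sin t - β * cos t) ∧
      h t = α * cos t + β * sin t := by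
  set m := (1 / (2 * π)) * ∫ s in (0:ℝ)..(2 * π), h s / (k ^ 2 - 1) with hm
  set A := g' 0 - k / q * h 0 with hA
  set C := k / q * A + k ^ 2 * m with hC
  have hgA (t : ℝ) : g' t = k / q * h t + A := by
    have hd (s : ℝ) : HasDerivAt (fun s => g' s - k / q * h s) 0 s := by
      refine HasDerivAt.congr_deriv ((hg' s).sub ((hh s).const_mul (k / q))) ?_
      ring
    have := is_const_of_deriv_eq_zero (fun s => (hd s).differentiableAt)
      (fun s => (hd s).deriv) t 0
    linarith
  have hosc (t : ℝ) : HasDerivAt h' (-(h t + C)) t := by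
    convert hh' t using 1
    rw [hgA t, hC, ← hqk]
    field_simp
    linear_combination -h t * hqk
  have hsol (t : ℝ) := eq_cos_add_sin_of_harmonic (fun s => (hh s).add_const C) hosc t
  set α := h 0 + C with hα
  set β := h' 0 with hβ
  have hsol' (t : ℝ) : h t = α * cos t + β * sin t - C := by linarith [hsol t]
  have hgsol (t : ℝ) : g t = g 0 + k / q * (α * sin t - β * cos t + β) + (A - k / q * C) * t := by
    have hd (s : ℝ) : HasDerivAt
        (fun s => g s - k / q * (α * sin s - β * cos s) - (A - k / q * C) * s) 0 s := by
      refine HasDerivAt.congr_deriv (((hg s).sub ((((hasDerivAt_sin s).const_mul α).sub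
        ((hasDerivAt_cos s).const_mul β)).const_mul (k / q))).sub
        ((hasDerivAt_id s).const_mul (A - k / q * C))) ?_
      rw [hgA s, hsol' s]
      ring
    have := is_const_of_deriv_eq_zero (fun s => (hd s).differentiableAt)
      (fun s => (hd s).deriv) t 0
    simp only [sin_zero, cos_zero] at this
    linarith
  have hAC : A = k / q * C := by
    have h2 := hgsol (2 * π)
    rw [hper, sin_two_pi, cos_two_pi] at h2
    have h3 : (A - k / q * C) * (2 * π) = 0 := by linarith
    have := (mul_eq_zero.1 h3).resolve_right two_pi_pos.ne'
    linarith
  have hint : ∫ s in (0:ℝ)..(2 * π), h s / (k ^ 2 - 1) = -(2 * π * C) / (k ^ 2 - 1) := by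
    rw [intervalIntegral.integral_div]
    congr 1
    simp_rw [hsol']
    rw [intervalIntegral.integral_sub, intervalIntegral.integral_add]
    · simp
    all_goals exact Continuous.intervalIntegrable (by fun_prop) _ _
  have hC0 : C = 0 := by
    have hmC : m = -C / q ^ 2 := by
      rw [hm, hint, ← hqk]
      field_simp
    rw [hmC, hAC] at hC
    rw [hC]
    field_simp
    ring
  refine ⟨α, β, g 0 + k / q * β, fun t => ⟨?_, ?_⟩⟩
  · rw [hgsol t, hAC]
    ring
  · rw [hsol' t, hC0, sub_zero]

/-- The span of `ω'`, `e₁`, `ω` in frame coordinates. -/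
lemma eq_combination_iff {k : ℝ} (hk : 1 < k) (φ : ℝ → ℝ × ℝ) (a b c t : ℝ) :
    φ t = a • deriv (om k) t + b • (((1:ℝ), (0:ℝ)) : ℝ × ℝ) + c • om k t ↔
      tangentCoord k φ t = a + b * (1 - k * sin t) + c * k * cos t ∧
      normalCoord k φ t = -√(k ^ 2 - 1) * (b * cos t + c * sin t) := by
  have hD := (sub_sin_pos hk t).ne'
  have hqq := sq_sqrt (sq_sub_one_pos hk).le
  have hcs := sin_sq_add_cos_sq t
  have hframe : (1 - k * sin t) ^ 2 + (√(k ^ 2 - 1) * cos t) ^ 2 ≠ 0 := by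
    rw [speed_identity hk]
    exact pow_ne_zero 2 hD
  rw [← sub_eq_zero, eq_zero_iff_frame hframe, deriv_om hk]
  simp only [tangentCoord, normalCoord, om, Rk, one_div_one_div, Prod.fst_add, Prod.snd_add,
    Prod.fst_sub, Prod.snd_sub, Prod.smul_fst, Prod.smul_snd, smul_eq_mul]
  generalize √(k ^ 2 - 1) = q at *
  generalize sin t = s at *
  generalize cos t = x at *
  have hT : (1 - k * s) * (a * ((1 - k * s) / (k - s) ^ 2) + b * 1 + c * (x / (k - s))) +
      q * x * (a * (q * x / (k - s) ^ 2) + b * 0 + c * (q / (k - s))) =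
      a + b * (1 - k * s) + c * k * x := by
    field_simp
    grind
  have hN : -(q * x) * (a * ((1 - k * s) / (k - s) ^ 2) + b * 1 + c * (x / (k - s))) +
      (1 - k * s) * (a * (q * x / (k - s) ^ 2) + b * 0 + c * (q / (k - s))) =
      -q * (b * x + c * s) := by
    field_simp
    grind
  refine and_congr ⟨fun h => ?_, fun h => ?_⟩ ⟨fun h => ?_, fun h => ?_⟩
  · linear_combination hT + h
  · linear_combination h - hT
  · linear_combination hN + h
  · linear_combination h - hN

/-- nondegeneracy: the kernel of the linearization `𝓙` at `ω` is exactly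
the span of `ω'`, `e₁` and `ω`. -/
theorem stmt_9 (k : ℝ) (hk : 1 < k) (φ : ℝ → ℝ × ℝ)
    (hφ : ContDiff ℝ 2 φ) (hper : Function.Periodic φ (2 * π)) :
    (∀ t : ℝ, Jop k φ t = 0) ↔
    ∃ a b c : ℝ, ∀ t : ℝ,
      φ t = a • deriv (om k) t + b • (((1:ℝ), (0:ℝ)) : ℝ × ℝ) + c • om k t := by
  have hqq := sq_sqrt (sq_sub_one_pos hk).le
  have hq := (sqrt_pos.2 (sq_sub_one_pos hk)).ne'
  simp only [Jop_eq_zero_iff hk hφ, eq_combination_iff hk]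
  constructor
  · intro hJ
    have hd := hφ.differentiable (by norm_num)
    obtain ⟨α, β, γ, hsol⟩ := periodic_system_solution hq hqq
      (fun t => (hasDerivAt_tangentCoord (k := k) (hd t).hasDerivAt).differentiableAt.hasDerivAt)
      (fun t => (hasDerivAt_normalCoord (k := k) (hd t).hasDerivAt).differentiableAt.hasDerivAt)
      (fun t => by
        rw [← (hJ t).1]
        exact (hasDerivAt_deriv_tangentCoord hφ t).differentiableAt.hasDerivAt)
      (fun t => by
        rw [← (hJ t).2]
        exact (hasDerivAt_deriv_normalCoord hφ t).differentiableAt.hasDerivAt)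
      (by simp [tangentCoord, hper.eq])
    refine ⟨γ + α / √(k ^ 2 - 1), -α / √(k ^ 2 - 1), -β / √(k ^ 2 - 1), fun t => ?_⟩
    rw [(hsol t).1, (hsol t).2]
    constructor
    · ring
    · field_simp
      ring
  · rintro ⟨a, b, c, hsol⟩ t
    have hT : tangentCoord k φ = fun t => a + b * (1 - k * sin t) + c * k * cos t :=
      funext fun t => (hsol t).1
    have hN : normalCoord k φ = fun t => -√(k ^ 2 - 1) * (b * cos t + c * sin t) :=
      funext fun t => (hsol t).2
    have hT' : deriv (tangentCoord k φ) = fun t => -k * (b * cos t + c * sin t) := by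
      rw [hT]
      funext s
      refine HasDerivAt.deriv ?_
      refine HasDerivAt.congr_deriv
        (((((((hasDerivAt_sin s).const_mul k).const_sub 1).const_mul b).const_add a).add
        ((hasDerivAt_cos s).const_mul (c * k)))) ?_
      ring
    have hS (s : ℝ) : HasDerivAt (fun t => b * cos t + c * sin t) (c * cos s - b * sin s) s := by
      refine HasDerivAt.congr_deriv
        (((hasDerivAt_cos s).const_mul b).add ((hasDerivAt_sin s).const_mul c)) ?_
      ring
    have hN' : deriv (normalCoord k φ) = fun t => -√(k ^ 2 - 1) * (c * cos t - b * sin t) := by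
      rw [hN]
      exact funext fun s => ((hS s).const_mul _).deriv
    have hS' : HasDerivAt (fun t => c * cos t - b * sin t) (-(b * cos t + c * sin t)) t := by
      refine HasDerivAt.congr_deriv
        (((hasDerivAt_cos t).const_mul c).sub ((hasDerivAt_sin t).const_mul b)) ?_
      ring
    have hint : ∫ s in (0:ℝ)..(2 * π), normalCoord k φ s / (k ^ 2 - 1) = 0 := by
      simp only [hN]
      rw [intervalIntegral.integral_div, intervalIntegral.integral_const_mul,
        intervalIntegral.integral_add]
      · simp
      all_goals exact Continuous.intervalIntegrable (by fun_prop) _ _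
    rw [hint, hT', hN', ((hS t).const_mul (-k)).deriv, (hS'.const_mul (-√(k ^ 2 - 1))).deriv, hN]
    simp only [mul_zero, sub_zero]
    generalize √(k ^ 2 - 1) = q at *
    rw [← hqq]
    constructor
    · field_simp
    · field_simp
      linear_combination (b * cos t + c * sin t) * hqq
end
end

section
/- Let k>1 and let φ : ℝ → ℝ² be C² and 2π-periodic. If there exist real numbers a, b, c such that ω₂⁻²𝓙(φ) = aω' + b(1,0) + cω pointwise on ℝ, then φ itself is a real linear combination of ω', (1,0), and ω. -/
open Real MeasureTheory Filter Topology

noncomputable section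

/-- A periodic function with nonnegative derivative has zero derivative. -/
lemma Function.Periodic.hasDerivAt_eq_zero_of_nonneg {W W' : ℝ → ℝ} {T : ℝ} (hT : 0 < T)
    (hper : Function.Periodic W T) (hW : ∀ t, HasDerivAt W (W' t) t) (hnonneg : ∀ t, 0 ≤ W' t)
    (t : ℝ) : W' t = 0 := by
  have hmono : Monotone W :=
    monotone_of_deriv_nonneg (fun t => (hW t).differentiableAt)
      (fun t => by rw [(hW t).deriv]; exact hnonneg t)
  have hloc : W =ᶠ[𝓝 t] fun _ => W t := by
    filter_upwards [Ioo_mem_nhds (sub_lt_self t hT) (lt_add_of_pos_right t hT)] with x hx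
    have hlow : W t ≤ W x := by
      have := hmono hx.1.le
      rwa [hper.sub_eq] at this
    have hup : W x ≤ W t := by
      have := hmono hx.2.le
      rwa [hper t] at this
    exact le_antisymm hup hlow
  exact (hW t).unique ((hasDerivAt_const t (W t)).congr_of_eventuallyEq hloc)

lemma Function.Periodic.of_hasDerivAt {f f' : ℝ → ℝ} {T : ℝ} (hper : Function.Periodic f T)
    (hf : ∀ t, HasDerivAt f (f' t) t) : Function.Periodic f' T := by
  intro t
  have hshift : HasDerivAt (fun x => f (x + T)) (f' (t + T)) t :=
    (hf (t + T)).comp_add_const t T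
  rw [show (fun x => f (x + T)) = f from funext hper] at hshift
  exact hshift.unique (hf t)

lemma eq_of_hasDerivAt_zero {f : ℝ → ℝ} (hf : ∀ t, HasDerivAt f 0 t) (x y : ℝ) : f x = f y :=
  is_const_of_deriv_eq_zero (fun t => (hf t).differentiableAt) (fun t => (hf t).deriv) x y

/-- The solutions of `q'' + q = C`. -/
lemma exists_eq_add_cos_add_sin {q q' q'' : ℝ → ℝ} {C : ℝ} (hq : ∀ t, HasDerivAt q (q' t) t)
    (hq' : ∀ t, HasDerivAt q' (q'' t) t) (heq : ∀ t, q'' t + q t = C) :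
    ∃ A B : ℝ, ∀ t, q t = C + A * cos t + B * sin t := by
  have hA : ∀ t, HasDerivAt (fun t => (q t - C) * cos t - q' t * sin t) 0 t := by
    intro t
    refine HasDerivAt.congr_deriv ((((hq t).sub_const C).mul (hasDerivAt_cos t)).sub
      ((hq' t).mul (hasDerivAt_sin t))) ?_
    linear_combination -sin t * heq t
  have hB : ∀ t, HasDerivAt (fun t => (q t - C) * sin t + q' t * cos t) 0 t := by
    intro t
    refine HasDerivAt.congr_deriv ((((hq t).sub_const C).mul (hasDerivAt_sin t)).add
      ((hq' t).mul (hasDerivAt_cos t))) ?_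
    linear_combination cos t * heq t
  refine ⟨(q 0 - C) * cos 0 - q' 0 * sin 0, (q 0 - C) * sin 0 + q' 0 * cos 0, fun t => ?_⟩
  rw [← eq_of_hasDerivAt_zero hA t 0, ← eq_of_hasDerivAt_zero hB t 0]
  linear_combination (C - q t) * sin_sq_add_cos_sq t

/-- If `B g`, with `g = (p, q)`, is a positive multiple of an element of the kernel of `B`,
then `B g = 0`. Here `r = k R_k` and `M = R_k² k² ⨍ q`. -/
lemma frame_source_eq_zero {p p' p'' q q' q'' w : ℝ → ℝ} {r ρ k s M a b c : ℝ}
    (hrs : r * s = k) (hrk : r * k = s + ρ * s)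
    (hp : ∀ t, HasDerivAt p (p' t) t) (hp' : ∀ t, HasDerivAt p' (p'' t) t)
    (hq : ∀ t, HasDerivAt q (q' t) t) (hq' : ∀ t, HasDerivAt q' (q'' t) t)
    (hpper : Function.Periodic p (2 * π)) (hqper : Function.Periodic q (2 * π))
    (hw : ∀ t, 0 < w t)
    (h₁ : ∀ t, -p'' t + r * q' t = w t * (a + b * (1 - k * sin t) + c * (k * cos t)))
    (h₂ : ∀ t, -q'' t - r * p' t + (ρ * q t - M) = w t * (b * (-s * cos t) + c * (-s * sin t)))
    (t : ℝ) :
    -p'' t + r * q' t = 0 ∧ -q'' t - r * p' t + (ρ * q t - M) = 0 := by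
  set P : ℝ → ℝ := fun t => a + b * (1 - k * sin t) + c * (k * cos t) with hPdef
  set P' : ℝ → ℝ := fun t => b * (-(k * cos t)) + c * (-(k * sin t)) with hP'def
  set Q : ℝ → ℝ := fun t => b * (-s * cos t) + c * (-s * sin t) with hQdef
  set Q' : ℝ → ℝ := fun t => b * (s * sin t) + c * (-s * cos t) with hQ'def
  have hP : ∀ t, HasDerivAt P (P' t) t := fun t => by
    refine HasDerivAt.congr_deriv
      (((((hasDerivAt_sin t).const_mul k).const_sub 1).const_mul b |>.const_add a).add
      (((hasDerivAt_cos t).const_mul k).const_mul c)) ?_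
    simp only [hP'def]; ring
  have hP' : ∀ t, HasDerivAt P' (r * Q' t) t := fun t => by
    refine HasDerivAt.congr_deriv ((((hasDerivAt_cos t).const_mul k).neg.const_mul b).add
      (((hasDerivAt_sin t).const_mul k).neg.const_mul c)) ?_
    simp only [hQ'def]; rw [← hrs]; ring
  have hQ : ∀ t, HasDerivAt Q (Q' t) t := fun t => by
    refine HasDerivAt.congr_deriv ((((hasDerivAt_cos t).const_mul (-s)).const_mul b).add
      (((hasDerivAt_sin t).const_mul (-s)).const_mul c)) ?_
    simp only [hQ'def]; ring
  have hQ' : ∀ t, HasDerivAt Q' (-r * P' t + ρ * Q t) t := fun t => by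
    refine HasDerivAt.congr_deriv ((((hasDerivAt_sin t).const_mul s).const_mul b).add
      (((hasDerivAt_cos t).const_mul (-s)).const_mul c)) ?_
    simp only [hP'def, hQdef]
    linear_combination -(b * cos t + c * sin t) * hrk
  have hW : ∀ t, HasDerivAt (fun t => -p' t * P t + p t * P' t - q' t * Q t + q t * Q' t
      + r * (q t * P t - p t * Q t) - M * (b * (-s * sin t) + c * (s * cos t)))
      (w t * (P t ^ 2 + Q t ^ 2)) t := fun t => by
    have hpr : HasDerivAt (fun t => b * (-s * sin t) + c * (s * cos t)) (Q t) t := by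
      refine HasDerivAt.congr_deriv ((((hasDerivAt_sin t).const_mul (-s)).const_mul b).add
        (((hasDerivAt_cos t).const_mul s).const_mul c)) ?_
      simp only [hQdef]; ring
    refine HasDerivAt.congr_deriv (((((((hp' t).neg.mul (hP t)).add ((hp t).mul (hP' t))).sub
      ((hq' t).mul (hQ t))).add ((hq t).mul (hQ' t))).add
      ((((hq t).mul (hP t)).sub ((hp t).mul (hQ t))).const_mul r)).sub (hpr.const_mul M)) ?_
    simp only [Pi.neg_apply]
    linear_combination P t * h₁ t + Q t * h₂ t
  have hWper : Function.Periodic (fun t => -p' t * P t + p t * P' t - q' t * Q t + q t * Q' t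
      + r * (q t * P t - p t * Q t) - M * (b * (-s * sin t) + c * (s * cos t))) (2 * π) := by
    intro t
    simp only [hPdef, hP'def, hQdef, hQ'def, hpper t, hqper t, hpper.of_hasDerivAt hp t,
      hqper.of_hasDerivAt hq t, sin_add_two_pi, cos_add_two_pi]
  have hzero := hWper.hasDerivAt_eq_zero_of_nonneg two_pi_pos hW
    (fun t => mul_nonneg (hw t).le (by positivity)) t
  have hsum : P t ^ 2 + Q t ^ 2 = 0 := (mul_eq_zero.mp hzero).resolve_left (hw t).ne'
  have hPt : P t = 0 := by nlinarith [sq_nonneg (P t), sq_nonneg (Q t)]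
  have hQt : Q t = 0 := by nlinarith [sq_nonneg (P t), sq_nonneg (Q t)]
  exact ⟨(h₁ t).trans (mul_eq_zero_of_right _ hPt), (h₂ t).trans (mul_eq_zero_of_right _ hQt)⟩

/-- The periodic solutions of `B g = 0`, with `g = (p, q)`. -/
lemma frame_kernel {p p' p'' q q' q'' : ℝ → ℝ} {r ρ : ℝ} (hrρ : r ^ 2 = 1 + ρ)
    (hp : ∀ t, HasDerivAt p (p' t) t) (hp' : ∀ t, HasDerivAt p' (p'' t) t)
    (hq : ∀ t, HasDerivAt q (q' t) t) (hq' : ∀ t, HasDerivAt q' (q'' t) t)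
    (hpper : Function.Periodic p (2 * π))
    (h₁ : ∀ t, -p'' t + r * q' t = 0)
    (h₂ : ∀ t, -q'' t - r * p' t
      + (ρ * q t - r ^ 2 * ((1 / (2 * π)) * ∫ s in (0:ℝ)..(2 * π), q s)) = 0) :
    ∃ p₀ A B : ℝ, ∀ t, p t = p₀ + r * (A * sin t - B * cos t) ∧ q t = A * cos t + B * sin t := by
  have hconst : ∀ t, HasDerivAt (fun t => p' t - r * q t) 0 t := fun t => by
    refine HasDerivAt.congr_deriv ((hp' t).sub ((hq t).const_mul r)) ?_
    linear_combination -h₁ t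
  set E := p' 0 - r * q 0 with hE
  have hp'eq : ∀ t, p' t = r * q t + E := fun t => by
    have : p' t - r * q t = E := eq_of_hasDerivAt_zero hconst t 0
    linear_combination this
  set m := (1 / (2 * π)) * ∫ s in (0:ℝ)..(2 * π), q s with hm
  obtain ⟨A, B, hAB⟩ := exists_eq_add_cos_add_sin (C := -r * E - r ^ 2 * m) hq hq' (fun t => by
    linear_combination -h₂ t - r * hp'eq t - q t * hrρ)
  set C := -r * E - r ^ 2 * m with hC
  have hmC : m = C := by
    rw [hm, funext hAB, intervalIntegral.integral_add, intervalIntegral.integral_add]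
    · simp
      field_simp
    all_goals exact Continuous.intervalIntegrable (by fun_prop) _ _
  have hlin : ∀ t, HasDerivAt (fun t => p t - r * (A * sin t - B * cos t) - (r * C + E) * t) 0 t :=
    fun t => by
      refine HasDerivAt.congr_deriv (((hp t).sub ((((hasDerivAt_sin t).const_mul A).sub
        ((hasDerivAt_cos t).const_mul B)).const_mul r)).sub
        ((hasDerivAt_id t).const_mul (r * C + E))) ?_
      linear_combination hp'eq t + r * hAB t
  have hslope : r * C + E = 0 := by
    have hend := eq_of_hasDerivAt_zero hlin (2 * π) 0
    have hpp : p (2 * π) = p 0 := by simpa using hpper 0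
    simp [hpp, pi_ne_zero] at hend
    exact hend
  have hC0 : C = 0 := by
    linear_combination hC - r ^ 2 * hmC - r * hslope
  refine ⟨p 0 + r * B, A, B, fun t => ⟨?_, ?_⟩⟩
  · have := eq_of_hasDerivAt_zero hlin t 0
    simp [hslope] at this
    linear_combination this
  · rw [hAB t, hC0]; ring

lemma hasDerivAt_fst {f : ℝ → ℝ × ℝ} {f' : ℝ × ℝ} {t : ℝ} (hf : HasDerivAt f f' t) :
    HasDerivAt (fun x => (f x).1) f'.1 t :=
  (ContinuousLinearMap.fst ℝ ℝ ℝ).hasFDerivAt.comp_hasDerivAt t hf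

lemma hasDerivAt_snd {f : ℝ → ℝ × ℝ} {f' : ℝ × ℝ} {t : ℝ} (hf : HasDerivAt f f' t) :
    HasDerivAt (fun x => (f x).2) f'.2 t :=
  (ContinuousLinearMap.snd ℝ ℝ ℝ).hasFDerivAt.comp_hasDerivAt t hf

/-- Derivatives of the components `(1 - k sin t, s cos t)` of `(k - sin t)² ω'(t)`. -/
lemma hasDerivAt_frame_fst (k t : ℝ) :
    HasDerivAt (fun t => 1 - k * sin t) (-(k * cos t)) t :=
  ((hasDerivAt_sin t).const_mul k).const_sub 1

lemma hasDerivAt_frame_snd (s t : ℝ) : HasDerivAt (fun t => s * cos t) (-(s * sin t)) t :=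
  ((hasDerivAt_cos t).const_mul s).congr_deriv (by ring)

lemma one_div_Rk (k : ℝ) : 1 / Rk k = √(k ^ 2 - 1) := by simp [Rk]

section Frame

/-! Pointwise algebra behind the conjugation of `𝓙` to `B` by the frame `(ω', iω')`. Here
`x = sin t`, `y = cos t`, `s = 1 / R_k`, and `f, g` are the components of `φ`. -/

variable {k s x y f f' f'' g g' g'' μ a b c : ℝ}

lemma frame_conj_fst (hs : s ≠ 0) (hD : k - x ≠ 0) (hsk : s ^ 2 = k ^ 2 - 1)
    (hxy : x ^ 2 + y ^ 2 = 1)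
    (h₁ : -f'' + k * (1 / s) * -g' + (s / (k - x))⁻¹ * (2 * g' * ((1 - k * x) / (k - x) ^ 2)
        - 2 * f' * -(s * y / (k - x) ^ 2))
      - g / (s / (k - x)) ^ 2 * (2 * ((1 - k * x) / (k - x) ^ 2) * (s * y / (k - x) ^ 2))
      - μ * -(s * y / (k - x) ^ 2)
      = (s / (k - x)) ^ 2 * (a * ((1 - k * x) / (k - x) ^ 2) + b + c * (y / (k - x))))
    (h₂ : -g'' + k * (1 / s) * f' + (s / (k - x))⁻¹ * (2 * g' * (s * y / (k - x) ^ 2)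
        - 2 * f' * ((1 - k * x) / (k - x) ^ 2))
      - g / (s / (k - x)) ^ 2 * ((s * y / (k - x) ^ 2) ^ 2 - ((1 - k * x) / (k - x) ^ 2) ^ 2)
      - μ * ((1 - k * x) / (k - x) ^ 2)
      = (s / (k - x)) ^ 2 * (a * (s * y / (k - x) ^ 2) + c * (s / (k - x)))) :
    -(f'' * (1 - k * x) + 2 * f' * -(k * y) + f * (k * x)
        + (g'' * (s * y) + 2 * g' * -(s * x) + g * -(s * y)))
      + k * (1 / s) * (g' * (1 - k * x) + g * -(k * y) - (f' * (s * y) + f * -(s * x)))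
      = (s / (k - x)) ^ 2 * (a + b * (1 - k * x) + c * (k * y)) := by
  linear_combination (norm := skip) (1 - k * x) * h₁ + s * y * h₂
  clear h₁ h₂
  field_simp
  grind

lemma frame_conj_snd (hs : s ≠ 0) (hD : k - x ≠ 0) (hsk : s ^ 2 = k ^ 2 - 1)
    (hxy : x ^ 2 + y ^ 2 = 1)
    (h₁ : -f'' + k * (1 / s) * -g' + (s / (k - x))⁻¹ * (2 * g' * ((1 - k * x) / (k - x) ^ 2)
        - 2 * f' * -(s * y / (k - x) ^ 2))
      - g / (s / (k - x)) ^ 2 * (2 * ((1 - k * x) / (k - x) ^ 2) * (s * y / (k - x) ^ 2))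
      - μ * -(s * y / (k - x) ^ 2)
      = (s / (k - x)) ^ 2 * (a * ((1 - k * x) / (k - x) ^ 2) + b + c * (y / (k - x))))
    (h₂ : -g'' + k * (1 / s) * f' + (s / (k - x))⁻¹ * (2 * g' * (s * y / (k - x) ^ 2)
        - 2 * f' * ((1 - k * x) / (k - x) ^ 2))
      - g / (s / (k - x)) ^ 2 * ((s * y / (k - x) ^ 2) ^ 2 - ((1 - k * x) / (k - x) ^ 2) ^ 2)
      - μ * ((1 - k * x) / (k - x) ^ 2)
      = (s / (k - x)) ^ 2 * (a * (s * y / (k - x) ^ 2) + c * (s / (k - x)))) :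
    -(g'' * (1 - k * x) + 2 * g' * -(k * y) + g * (k * x)
        - (f'' * (s * y) + 2 * f' * -(s * x) + f * -(s * y)))
      - k * (1 / s) * (f' * (1 - k * x) + f * -(k * y) + (g' * (s * y) + g * -(s * x)))
      + ((1 / s) ^ 2 * (g * (1 - k * x) - f * (s * y)) - μ)
      = (s / (k - x)) ^ 2 * (b * (-s * y) + c * (-s * x)) := by
  linear_combination (norm := skip) (1 - k * x) * h₂ - s * y * h₁
  clear h₁ h₂
  field_simp
  grind

end Frame

/-- if `ω₂⁻²𝓙(φ)` lies in the span of `ω'`, `e₁`, `ω`, then `φ` itself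
lies in that span. -/
theorem stmt_10 (k : ℝ) (hk : 1 < k) (φ : ℝ → ℝ × ℝ)
    (hφ : ContDiff ℝ 2 φ) (hper : Function.Periodic φ (2 * π))
    (a b c : ℝ)
    (h : ∀ t : ℝ, ((om k t).2 ^ 2)⁻¹ • Jop k φ t
        = a • deriv (om k) t + b • (((1:ℝ), (0:ℝ)) : ℝ × ℝ) + c • om k t) :
    ∃ a' b' c' : ℝ, ∀ t : ℝ,
      φ t = a' • deriv (om k) t + b' • (((1:ℝ), (0:ℝ)) : ℝ × ℝ) + c' • om k t := by
  set s := √(k ^ 2 - 1) with hsdef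
  have hpos : 0 < k ^ 2 - 1 := by nlinarith
  have hs : s ≠ 0 := (Real.sqrt_pos.mpr hpos).ne'
  have hsk : s ^ 2 = k ^ 2 - 1 := Real.sq_sqrt hpos.le
  have hR : Rk k = 1 / s := rfl
  have hD : ∀ t, k - sin t ≠ 0 := fun t => by linarith [sin_le_one t]
  have hom : ∀ t, om k t = (cos t / (k - sin t), s / (k - sin t)) := fun t => by
    rw [om, one_div_Rk]
  have hom' : ∀ t, deriv (om k) t =
      ((1 - k * sin t) / (k - sin t) ^ 2, s * cos t / (k - sin t) ^ 2) :=
    fun t => (hasDerivAt_om hk t).deriv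
  have hφ₁ : ∀ t, HasDerivAt φ (deriv φ t) t :=
    fun t => (hφ.differentiable two_ne_zero t).hasDerivAt
  have hφ₂ : ∀ t, HasDerivAt (deriv φ) (deriv (deriv φ) t) t := fun t =>
    ((ContDiff.deriv' (n := 1) hφ).differentiable one_ne_zero t).hasDerivAt
  set p : ℝ → ℝ := fun t => (φ t).1 * (1 - k * sin t) + (φ t).2 * (s * cos t) with hpdef
  set q : ℝ → ℝ := fun t => (φ t).2 * (1 - k * sin t) - (φ t).1 * (s * cos t) with hqdef
  set p' : ℝ → ℝ := fun t => (deriv φ t).1 * (1 - k * sin t) + (φ t).1 * -(k * cos t)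
    + ((deriv φ t).2 * (s * cos t) + (φ t).2 * -(s * sin t)) with hp'def
  set q' : ℝ → ℝ := fun t => (deriv φ t).2 * (1 - k * sin t) + (φ t).2 * -(k * cos t)
    - ((deriv φ t).1 * (s * cos t) + (φ t).1 * -(s * sin t)) with hq'def
  set p'' : ℝ → ℝ := fun t => (deriv (deriv φ) t).1 * (1 - k * sin t)
    + 2 * (deriv φ t).1 * -(k * cos t) + (φ t).1 * (k * sin t)
    + ((deriv (deriv φ) t).2 * (s * cos t) + 2 * (deriv φ t).2 * -(s * sin t)
      + (φ t).2 * -(s * cos t)) with hp''def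
  set q'' : ℝ → ℝ := fun t => (deriv (deriv φ) t).2 * (1 - k * sin t)
    + 2 * (deriv φ t).2 * -(k * cos t) + (φ t).2 * (k * sin t)
    - ((deriv (deriv φ) t).1 * (s * cos t) + 2 * (deriv φ t).1 * -(s * sin t)
      + (φ t).1 * -(s * cos t)) with hq''def
  have hX := hasDerivAt_frame_fst k
  have hY := hasDerivAt_frame_snd s
  have hX' : ∀ t, HasDerivAt (fun t => -(k * cos t)) (k * sin t) t := fun t =>
    ((hasDerivAt_cos t).const_mul k).neg.congr_deriv (by ring)
  have hY' : ∀ t, HasDerivAt (fun t => -(s * sin t)) (-(s * cos t)) t := fun t =>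
    ((hasDerivAt_sin t).const_mul s).neg
  have hp : ∀ t, HasDerivAt p (p' t) t := fun t =>
    ((hasDerivAt_fst (hφ₁ t)).mul (hX t)).add ((hasDerivAt_snd (hφ₁ t)).mul (hY t))
  have hq : ∀ t, HasDerivAt q (q' t) t := fun t =>
    ((hasDerivAt_snd (hφ₁ t)).mul (hX t)).sub ((hasDerivAt_fst (hφ₁ t)).mul (hY t))
  have hp' : ∀ t, HasDerivAt p' (p'' t) t := fun t =>
    ((((hasDerivAt_fst (hφ₂ t)).mul (hX t)).add ((hasDerivAt_fst (hφ₁ t)).mul (hX' t))).add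
      (((hasDerivAt_snd (hφ₂ t)).mul (hY t)).add ((hasDerivAt_snd (hφ₁ t)).mul (hY' t))))
      |>.congr_deriv (by simp only [hp''def]; ring)
  have hq' : ∀ t, HasDerivAt q' (q'' t) t := fun t =>
    ((((hasDerivAt_snd (hφ₂ t)).mul (hX t)).add ((hasDerivAt_snd (hφ₁ t)).mul (hX' t))).sub
      (((hasDerivAt_fst (hφ₂ t)).mul (hY t)).add ((hasDerivAt_fst (hφ₁ t)).mul (hY' t))))
      |>.congr_deriv (by simp only [hq''def]; ring)
  have hpper : Function.Periodic p (2 * π) := fun t => by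
    simp only [hpdef, hper t, sin_add_two_pi, cos_add_two_pi]
  have hqper : Function.Periodic q (2 * π) := fun t => by
    simp only [hqdef, hper t, sin_add_two_pi, cos_add_two_pi]
  have hμ : k ^ 2 * ((1 / (2 * π)) * ∫ t in (0:ℝ)..(2 * π),
      dotp (φ t) (rot (deriv (om k) t)) / (om k t).2 ^ 2)
      = (k * (1 / s)) ^ 2 * ((1 / (2 * π)) * ∫ t in (0:ℝ)..(2 * π), q t) := by
    have hint : (fun t => dotp (φ t) (rot (deriv (om k) t)) / (om k t).2 ^ 2)
        = fun t => (1 / s) ^ 2 * q t := by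
      funext t
      have := hD t
      simp only [hom, hom', dotp, rot, hqdef]
      field_simp
      ring
    rw [hint, intervalIntegral.integral_const_mul]
    ring
  have hsource : ∀ t,
      (-p'' t + k * (1 / s) * q' t
        = (s / (k - sin t)) ^ 2 * (a + b * (1 - k * sin t) + c * (k * cos t))) ∧
      (-q'' t - k * (1 / s) * p' t + ((1 / s) ^ 2 * q t
          - (k * (1 / s)) ^ 2 * ((1 / (2 * π)) * ∫ t in (0:ℝ)..(2 * π), q t))
        = (s / (k - sin t)) ^ 2 * (b * (-s * cos t) + c * (-s * sin t))) := by
    intro t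
    have hJ : Jop k φ t = ((om k t).2 ^ 2)
        • (a • deriv (om k) t + b • (((1:ℝ), (0:ℝ)) : ℝ × ℝ) + c • om k t) := by
      rw [← h t, smul_inv_smul₀]
      simp [hom, hs, hD]
    rw [Jop, hμ, hR] at hJ
    simp only [hom, hom'] at hJ
    have h₁ := congrArg Prod.fst hJ
    have h₂ := congrArg Prod.snd hJ
    simp only [rot, Gam, Gam', Prod.fst_add, Prod.snd_add, Prod.fst_sub, Prod.snd_sub,
      Prod.fst_neg, Prod.snd_neg, Prod.smul_fst, Prod.smul_snd, smul_eq_mul, mul_one, mul_zero,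
      add_zero] at h₁ h₂
    exact ⟨frame_conj_fst hs (hD t) hsk (sin_sq_add_cos_sq t) h₁ h₂,
      frame_conj_snd hs (hD t) hsk (sin_sq_add_cos_sq t) h₁ h₂⟩
  have hzero := frame_source_eq_zero (r := k * (1 / s)) (ρ := (1 / s) ^ 2) (k := k) (s := s)
    (by field_simp) (by field_simp; linear_combination -hsk) hp hp' hq hq' hpper hqper
    (fun t => pow_pos (div_pos (Real.sqrt_pos.mpr hpos) (by linarith [sin_le_one t])) 2)
    (fun t => (hsource t).1) (fun t => (hsource t).2)
  obtain ⟨p₀, A, B, hAB⟩ := frame_kernel (by field_simp; linear_combination -hsk)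
    hp hp' hq hq' hpper (fun t => (hzero t).1) (fun t => (hzero t).2)
  refine ⟨p₀ + A / s, -A / s, -B / s, fun t => ?_⟩
  obtain ⟨hpt, hqt⟩ := hAB t
  simp only [hpdef, hqdef] at hpt hqt
  have hDt := hD t
  have hnorm : (1 - k * sin t) ^ 2 + (s * cos t) ^ 2 = (k - sin t) ^ 2 := by
    linear_combination cos t ^ 2 * hsk + (k ^ 2 - 1) * sin_sq_add_cos_sq t
  have hfst : (φ t).1 = ((1 - k * sin t) * (p₀ + k * (1 / s) * (A * sin t - B * cos t))
      - s * cos t * (A * cos t + B * sin t)) / (k - sin t) ^ 2 := by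
    rw [eq_div_iff (pow_ne_zero 2 hDt)]
    linear_combination -(φ t).1 * hnorm + (1 - k * sin t) * hpt - s * cos t * hqt
  have hsnd : (φ t).2 = (s * cos t * (p₀ + k * (1 / s) * (A * sin t - B * cos t))
      + (1 - k * sin t) * (A * cos t + B * sin t)) / (k - sin t) ^ 2 := by
    rw [eq_div_iff (pow_ne_zero 2 hDt)]
    linear_combination -(φ t).2 * hnorm + s * cos t * hpt + (1 - k * sin t) * hqt
  have hsc := sin_sq_add_cos_sq t
  clear_value s
  rw [hom, hom']
  refine Prod.ext ?_ ?_
  · simp only [Prod.fst_add, Prod.smul_fst, smul_eq_mul, hfst]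
    field_simp
    grind
  · simp only [Prod.snd_add, Prod.smul_snd, smul_eq_mul, hsnd]
    field_simp
    grind
end
end
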